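/- Let a₁ ∈ O_D be a pure quaternion with ‖N(a₁)‖ ≥ 1/2, let t ≥ 1 be a natural number, and suppose r₀ ∈ O_D satisfies the k-star conditions for (a₁, t), with ‖N(1 − r₀)‖ ≥ 1/4, and such that z₀ = a₁ − r₀·a₁·(star r₀) satisfies ‖N(z₀)‖ = 2^(−2t)·‖N(a₁)‖. Then every α ∈ O_D with r₀ − α ∈ 2^(t+3)·O_D (i.e., r₀ = α + 2^(t+3)·β for some β ∈ O_D) also satisfies the k-star conditions for (a₁, t). (This is the sharpened reduction, with modulus π^u for u = t + 3e, valid when |z₀| attains its maximal value |π^t a₁|.) -/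

import Mathlib

open Quaternion

noncomputable section

/-- `D` is the quaternion algebra `ℍ[ℚ₂, 2, 5]` with `i² = 2`, `j² = 5`, `i·j = -j·i`;
this is the unique quaternion division algebra over `ℚ₂`. -/
abbrev D : Type := ℍ[ℚ_[2], 2, 5]

/-- The basis quaternion `i`. -/
def qi : D := ⟨0, 1, 0, 0⟩

/-- The basis quaternion `j`. -/
def qj : D := ⟨0, 0, 1, 0⟩

/-- `ω = (1 + j)/2`. -/
def qω : D := ⟨1/2, 0, 1/2, 0⟩

/-- The reduced norm `N(q) = q · (star q)` (as a scalar). -/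
def qN (q : D) : ℚ_[2] := (q * star q).re

/-- The reduced trace `T(q) = q + star q = 2·q.re` (as a scalar). -/
def qT (q : D) : ℚ_[2] := 2 * q.re

/-- `r` satisfies the k-star conditions for `(a₁, t)`: with `z = a₁ - r·a₁·(star r)`,
(i) `N(1-r)` is not represented by `x² + N(a₁)·y²` over `ℚ₂` (Hilbert symbol `-1`),
(ii) `N(z)·N(a₁)` is a nonzero square, and (iii) `‖N(z)‖ ≤ 2^(-2t)·‖N(a₁)‖`. -/
def kStar (a₁ : D) (t : ℕ) (r : D) : Prop :=
  (¬ ∃ x y : ℚ_[2], qN (1 - r) = x ^ 2 + qN a₁ * y ^ 2) ∧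
  (∃ c : ℚ_[2], c ≠ 0 ∧ qN (a₁ - r * a₁ * star r) * qN a₁ = c ^ 2) ∧
  ‖qN (a₁ - r * a₁ * star r)‖ ≤ (2 : ℝ) ^ (-(2 * (t : ℤ))) * ‖qN a₁‖

lemma qN_eq (q : D) : qN q = q.re ^ 2 - 2 * q.imI ^ 2 - 5 * q.imJ ^ 2 + 10 * q.imK ^ 2 := by
  simp [qN]; ring

lemma qN_mul (p q : D) : qN (p * q) = qN p * qN q := by
  simp only [qN_eq]; simp; ring

lemma qN_star (q : D) : qN (star q) = qN q := by
  simp only [qN_eq]; simp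

lemma qN_neg (q : D) : qN (-q) = qN q := by
  simp only [qN_eq]; simp

lemma qN_add (p q : D) : qN (p + q) = qN p + qN q + 2 * (p * star q).re := by
  simp only [qN_eq]; simp; ring

lemma qN_two_pow (n : ℕ) : qN ((2 : D) ^ n) = (2 ^ n) ^ 2 := by
  induction n with
  | zero => simp [qN_eq]
  | succ n ih =>
    rw [pow_succ, qN_mul, ih]
    have : qN (2 : D) = 4 := by
      have h : (2 : D) = 1 + 1 := by norm_num
      rw [h, qN_eq]; simp; norm_num
    rw [this]; ring

lemma norm_two' : ‖(2 : ℚ_[2])‖ = 1 / 2 := by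
  have := Padic.norm_p (p := 2)
  simpa using this

lemma norm_five' : ‖(5 : ℚ_[2])‖ = 1 := by
  have h : (5 : ℚ_[2]) = ((5 : ℕ) : ℚ_[2]) := by norm_num
  rw [h, Padic.norm_natCast_eq_one_iff]; decide

lemma lt_one_half {x : ℚ_[2]} (h : ‖x‖ < 1) : ‖x‖ ≤ 1 / 2 := by
  have := (Padic.norm_le_pow_iff_norm_lt_pow_add_one x (-1)).2 (by simpa using h)
  simpa using this

lemma unit_sub_one {v : ℚ_[2]} (h : ‖v‖ = 1) : ‖v - 1‖ < 1 := by
  let u : ℤ_[2] := ⟨v, h.le⟩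
  have hu : ‖u‖ = 1 := h
  have hm : u - 1 ∈ IsLocalRing.maximalIdeal ℤ_[2] := by
    rw [← PadicInt.ker_toZMod, RingHom.mem_ker, map_sub, map_one]
    have : PadicInt.toZMod u ≠ 0 := by
      intro h0
      have : u ∈ IsLocalRing.maximalIdeal ℤ_[2] := by
        rw [← PadicInt.ker_toZMod, RingHom.mem_ker]; exact h0
      rw [IsLocalRing.mem_maximalIdeal, PadicInt.mem_nonunits] at this
      linarith
    generalize PadicInt.toZMod u = w at *
    revert w; decide
  rw [IsLocalRing.mem_maximalIdeal, PadicInt.mem_nonunits] at hm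
  exact hm

lemma form_norm (x y : ℚ_[2]) : ∃ s : ℚ_[2], ‖x ^ 2 - 5 * y ^ 2‖ = ‖s‖ ^ 2 ∧ ‖2 * x‖ ≤ ‖s‖ := by
  have h5 : ‖-(5 * y ^ 2)‖ = ‖y‖ ^ 2 := by
    rw [norm_neg, norm_mul, norm_five', norm_pow, one_mul]
  have h2x : ‖2 * x‖ ≤ ‖x‖ := by
    rw [norm_mul, norm_two']; nlinarith [norm_nonneg x]
  by_cases hxy : ‖x‖ = ‖y‖
  · by_cases hy : y = 0
    · subst hy
      exact ⟨x, by simp, h2x⟩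
    refine ⟨2 * y, ?_, by rw [norm_mul, norm_mul, hxy]⟩
    have hy0 : ‖y‖ ≠ 0 := by simpa using hy
    obtain ⟨v, rfl⟩ : ∃ v, x = v * y := ⟨x / y, by field_simp⟩
    have hv : ‖v‖ = 1 := by
      rw [norm_mul] at hxy
      exact mul_right_cancel₀ hy0 (by linarith)
    have h1 := lt_one_half (unit_sub_one hv)
    obtain ⟨w, hw⟩ : ∃ w, v = 1 + 2 * w := ⟨(v - 1) / 2, by ring⟩
    have hw1 : ‖w‖ ≤ 1 := by
      have : v - 1 = 2 * w := by rw [hw]; ring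
      rw [this, norm_mul, norm_two'] at h1; linarith
    have hww : ‖w * (w + 1)‖ < 1 := by
      rw [norm_mul]
      have hw2 : ‖w + 1‖ ≤ 1 := (Padic.nonarchimedean w 1).trans (by simp [hw1])
      rcases hw1.lt_or_eq with h | h
      · nlinarith [norm_nonneg w, norm_nonneg (w + 1)]
      · have h3 := unit_sub_one h
        have : w + 1 = (w - 1) + 2 := by ring
        have h4 : ‖w + 1‖ < 1 := by
          rw [this]
          exact (Padic.nonarchimedean _ _).trans_lt (by rw [max_lt_iff, norm_two']; exact ⟨h3, by norm_num⟩)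
        rw [h, one_mul]; exact h4
    have hu : ‖w * (w + 1) + (-1)‖ = 1 := by
      rw [Padic.add_eq_max_of_ne (by simpa using hww.ne)]
      simpa using hww.le
    have : (v * y) ^ 2 - 5 * y ^ 2 = (2 * y) ^ 2 * (w * (w + 1) + (-1)) := by rw [hw]; ring
    rw [this, norm_mul, hu, norm_pow, mul_one]
  · have hne : ‖x ^ 2‖ ≠ ‖-(5 * y ^ 2)‖ := by
      rw [h5, norm_pow]
      intro h
      exact hxy ((pow_left_inj₀ (norm_nonneg _) (norm_nonneg _) two_ne_zero).1 h)
    rw [sub_eq_add_neg, Padic.add_eq_max_of_ne hne, h5, norm_pow]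
    rcases le_total ‖x‖ ‖y‖ with h | h
    · exact ⟨y, max_eq_right (by gcongr), h2x.trans h⟩
    · exact ⟨x, max_eq_left (by gcongr), h2x⟩

lemma parity {s u : ℚ_[2]} (hs : s ≠ 0) : ‖s‖ ^ 2 ≠ ‖(2 : ℚ_[2])‖ * ‖u‖ ^ 2 := by
  intro h
  by_cases hu : u = 0
  · subst hu; simp at h; exact hs h
  rw [Padic.norm_eq_zpow_neg_valuation hs, Padic.norm_eq_zpow_neg_valuation hu, norm_two'] at h
  have h2 : (1 / 2 : ℝ) = (2 : ℝ) ^ (-1 : ℤ) := by norm_num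
  rw [h2] at h
  simp only [Nat.cast_ofNat] at h
  rw [← zpow_natCast, ← zpow_natCast, ← zpow_mul, ← zpow_mul, ← zpow_add₀ (by norm_num)] at h
  have := zpow_right_injective₀ (by norm_num : (0 : ℝ) < 2) (by norm_num) h
  push_cast at this
  omega

lemma trace_bound (q : D) : ‖2 * q.re‖ ^ 2 ≤ ‖qN q‖ := by
  obtain ⟨s, hs, hs2⟩ := form_norm q.re q.imJ
  obtain ⟨u, hu, -⟩ := form_norm q.imI q.imK
  by_cases h0 : s = 0
  · subst h0
    rw [norm_zero] at hs2
    have : ‖2 * q.re‖ = 0 := le_antisymm hs2 (norm_nonneg _)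
    rw [this]; simp
  have e : qN q = (q.re ^ 2 - 5 * q.imJ ^ 2) + -(2 * (q.imI ^ 2 - 5 * q.imK ^ 2)) := by
    rw [qN_eq]; ring
  have hne : ‖q.re ^ 2 - 5 * q.imJ ^ 2‖ ≠ ‖-(2 * (q.imI ^ 2 - 5 * q.imK ^ 2))‖ := by
    rw [norm_neg, norm_mul, hs, hu]; exact parity h0
  rw [e, Padic.add_eq_max_of_ne hne, hs]
  exact le_max_of_le_left (by gcongr)

lemma qN_add_le {p q : D} {M : ℝ} (hp : ‖qN p‖ ≤ M) (hq : ‖qN q‖ ≤ M) : ‖qN (p + q)‖ ≤ M := by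
  have hM : 0 ≤ M := (norm_nonneg _).trans hp
  rw [qN_add]
  refine (Padic.nonarchimedean _ _).trans (max_le ((Padic.nonarchimedean _ _).trans (max_le hp hq)) ?_)
  have := trace_bound (p * star q)
  rw [qN_mul, qN_star, norm_mul (qN _)] at this
  refine (pow_le_pow_iff_left₀ (norm_nonneg _) hM two_ne_zero).1 (this.trans ?_)
  rw [sq]; gcongr

lemma sq_of_close {e : ℚ_[2]} (he : ‖e‖ ≤ 1 / 8) : ∃ s : ℚ_[2], ‖s‖ = 1 ∧ 1 + e = s ^ 2 := by
  let e' : ℤ_[2] := ⟨e, by linarith⟩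
  have he' : ‖e'‖ ≤ 1 / 8 := he
  have h2 : ‖(2 : ℤ_[2])‖ = 1 / 2 := by
    have := PadicInt.norm_p (p := 2)
    simpa using this
  obtain ⟨z, hz, -⟩ := hensels_lemma (p := 2) (R := ℤ_[2])
    (F := Polynomial.X ^ 2 - Polynomial.C (1 + e')) (a := 1) (by
      simp [one_add_one_eq_two, h2]; linarith)
  have hz' : z ^ 2 = 1 + e' := by
    simp [sub_eq_zero] at hz; exact hz
  have hzz : (z : ℚ_[2]) ^ 2 = 1 + e := by
    have := congrArg (fun x : ℤ_[2] => (x : ℚ_[2])) hz'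
    simpa using this
  refine ⟨z, ?_, hzz.symm⟩
  have h1 : ‖(z : ℚ_[2]) ^ 2‖ = 1 := by
    rw [hzz, Padic.add_eq_max_of_ne (by rw [norm_one]; intro h; linarith), norm_one]
    exact max_eq_left (by linarith)
  rw [norm_pow] at h1
  exact (pow_eq_one_iff_of_nonneg (norm_nonneg _) two_ne_zero).1 h1

lemma qN_close {x y : D} (hx : qN x ≠ 0) (h : ‖qN y‖ ≤ 1 / 64 * ‖qN x‖) :
    ∃ s : ℚ_[2], ‖s‖ = 1 ∧ qN (x + y) = qN x * s ^ 2 := by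
  have hpos : 0 < ‖qN x‖ := norm_pos_iff.2 hx
  have ht : ‖2 * (x * star y).re‖ ≤ 1 / 8 * ‖qN x‖ := by
    have := trace_bound (x * star y)
    rw [qN_mul, qN_star, norm_mul (qN _)] at this
    refine (pow_le_pow_iff_left₀ (norm_nonneg _) (by positivity) two_ne_zero).1 (this.trans ?_)
    nlinarith
  obtain ⟨s, hs, hs2⟩ := sq_of_close (e := (qN y + 2 * (x * star y).re) / qN x) (by
    rw [norm_div, div_le_iff₀ hpos]
    exact (Padic.nonarchimedean _ _).trans (max_le (by linarith) ht))
  refine ⟨s, hs, ?_⟩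
  rw [← hs2, qN_add]; field_simp; ring

/-- Sharpened reduction modulo `2^(t+3)`: if `r₀ ∈ O_D` satisfies the k-star conditions
for `(a₁, t)`, with `‖N(1 - r₀)‖ ≥ 1/4` and `‖N(z₀)‖ = 2^(-2t)·‖N(a₁)‖` where
`z₀ = a₁ - r₀·a₁·(star r₀)`, then any `α ∈ O_D` congruent to `r₀` modulo `2^(t+3)·O_D`
also satisfies the k-star conditions for `(a₁, t)`. -/
theorem stmt_6 (a₁ : D) (ha₁pure : star a₁ = -a₁) (ha₁int : ‖qN a₁‖ ≤ 1)
    (ha₁ : (1 / 2 : ℝ) ≤ ‖qN a₁‖) (t : ℕ) (ht : 1 ≤ t)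
    (r₀ : D) (hr₀int : ‖qN r₀‖ ≤ 1) (hks : kStar a₁ t r₀)
    (hr₀ : (1 / 4 : ℝ) ≤ ‖qN (1 - r₀)‖)
    (hz₀ : ‖qN (a₁ - r₀ * a₁ * star r₀)‖ = (2 : ℝ) ^ (-(2 * (t : ℤ))) * ‖qN a₁‖)
    (α : D) (hαint : ‖qN α‖ ≤ 1)
    (hmod : ∃ β : D, ‖qN β‖ ≤ 1 ∧ r₀ = α + 2 ^ (t + 3) * β) :
    kStar a₁ t α := by
  obtain ⟨β, hβ, hr⟩ := hmod
  obtain ⟨h1, ⟨c, hc, h2⟩, h3⟩ := hks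
  have hNa : qN a₁ ≠ 0 := by
    intro h; rw [h, norm_zero] at ha₁; norm_num at ha₁
  have hNapos : 0 < ‖qN a₁‖ := norm_pos_iff.2 hNa
  have hN1 : qN (1 - r₀) ≠ 0 := by
    intro h; rw [h, norm_zero] at hr₀; norm_num at hr₀
  have hNz : qN (a₁ - r₀ * a₁ * star r₀) ≠ 0 := by
    intro h; rw [h, zero_mul] at h2; exact hc (pow_eq_zero_iff two_ne_zero |>.1 h2.symm)
  have hpw : ‖qN ((2 : D) ^ (t + 3))‖ = 1 / 64 * (2 : ℝ) ^ (-(2 * (t : ℤ))) := by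
    rw [qN_two_pow, norm_pow, norm_pow, norm_two', zpow_neg, zpow_mul, zpow_natCast, pow_add, mul_pow,
      ← pow_mul, mul_comm t 2, pow_mul]
    norm_num
    rw [one_div, inv_pow]; ring
  have hpt : (2 : ℝ) ^ (-(2 * (t : ℤ))) ≤ 1 / 4 := by
    have : (1 / 4 : ℝ) = 2 ^ (-2 : ℤ) := by norm_num
    rw [this]
    exact zpow_le_zpow_right₀ (by norm_num) (by omega)
  have hp0 : (0 : ℝ) < (2 : ℝ) ^ (-(2 * (t : ℤ))) := by positivity
  rw [kStar]
  generalize (2 : ℝ) ^ (-(2 * (t : ℤ))) = P at *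
  have hstarh : star ((2 : D) ^ (t + 3)) = 2 ^ (t + 3) := by
    rw [star_pow, star_ofNat]
  have hcomm : ∀ q : D, q * 2 ^ (t + 3) = 2 ^ (t + 3) * q := fun q =>
    ((Commute.ofNat_right q 2).pow_right _).eq
  have hh1 : ‖qN ((2 : D) ^ (t + 3))‖ ≤ 1 := by rw [hpw]; linarith
  generalize (2 : D) ^ (t + 3) = h at *
  obtain ⟨s, hs, hs2⟩ := qN_close (x := 1 - r₀) (y := h * β) hN1 (by
    rw [qN_mul, norm_mul, hpw]
    calc 1 / 64 * P * ‖qN β‖ ≤ 1 / 64 * P * 1 := by gcongr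
      _ ≤ _ := by linarith)
  have e1 : 1 - r₀ + h * β = 1 - α := by rw [hr]; abel
  have hα : α = r₀ - h * β := by rw [hr]; abel
  rw [e1] at hs2
  have hw : ‖qN (β * a₁ * star r₀ + (r₀ * a₁ * star β + -(h * (β * a₁ * star β))))‖ ≤ ‖qN a₁‖ := by
    have key : ∀ p q : D, ‖qN p‖ ≤ 1 → ‖qN q‖ ≤ 1 → ‖qN (p * a₁ * star q)‖ ≤ ‖qN a₁‖ := by
      intro p q hp hq
      rw [qN_mul, qN_mul, qN_star, norm_mul, norm_mul]
      calc _ ≤ 1 * ‖qN a₁‖ * 1 := by gcongr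
        _ = _ := by ring
    refine qN_add_le (key _ _ hβ hr₀int) (qN_add_le (key _ _ hr₀int hβ) ?_)
    rw [qN_neg, qN_mul, norm_mul]
    calc _ ≤ 1 * ‖qN a₁‖ := by gcongr; exact key _ _ hβ hβ
      _ = _ := one_mul _
  obtain ⟨v, hv, hv2⟩ := qN_close (x := a₁ - r₀ * a₁ * star r₀)
    (y := h * (β * a₁ * star r₀ + (r₀ * a₁ * star β + -(h * (β * a₁ * star β))))) hNz (by
    rw [qN_mul, norm_mul, hpw, hz₀]
    calc _ ≤ 1 / 64 * P * ‖qN a₁‖ := by gcongr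
      _ = _ := by ring)
  have e2 : a₁ - r₀ * a₁ * star r₀ +
      h * (β * a₁ * star r₀ + (r₀ * a₁ * star β + -(h * (β * a₁ * star β)))) =
      a₁ - α * a₁ * star α := by
    have hx : ∀ x : D, r₀ * a₁ * (star β * h) = h * (r₀ * a₁ * star β) := by
      intro _; rw [← mul_assoc, hcomm]
    have hy : h * β * a₁ * (star β * h) = h * (h * (β * a₁ * star β)) := by
      rw [← mul_assoc, hcomm]; simp only [mul_assoc]
    rw [hα, star_sub, star_mul, hstarh, sub_mul, sub_mul, mul_sub, mul_sub, hx 0, hy]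
    simp only [mul_add, mul_neg, mul_assoc]
    abel
  rw [e2] at hv2
  have hs0 : s ≠ 0 := by rintro rfl; simp at hs
  have hv0 : v ≠ 0 := by rintro rfl; simp at hv
  refine ⟨?_, ⟨c * v, mul_ne_zero hc hv0, ?_⟩, ?_⟩
  · rintro ⟨x, y, hxy⟩
    refine h1 ⟨x / s, y / s, ?_⟩
    rw [hs2] at hxy
    field_simp
    exact hxy
  · rw [hv2, mul_pow, ← h2]; ring
  · rw [hv2, norm_mul, norm_pow, hv, one_pow, mul_one]; exact h3
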